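/- arXiv:1807.02353 — 2 statements merged into one kernel-verified Lean document; each statement's English description precedes it below -/
import Mathlib

section
/- Let (𝒜, ℬ, θ_*, θ^*) be an Ω-system such that 𝒜 has enough projectives, and assume that the essential image of θ^* is closed under subobjects and closed under extensions in 𝒜. Then every projective object X of ℬ admits an Ω-resolution. -/
open CategoryTheory CategoryTheory.Limits

/-- An Ω-system: abelian categories `A`, `B` with additive functors `push : A ⥤ B`
(denoted `θ_*`) and `pull : B ⥤ A` (denoted `θ^*`) such that (OP1) `push` is left adjoint
to `pull`, (OP2) the counit of the adjunction is an isomorphism, and (OP3) `pull`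
sends epimorphisms to epimorphisms. -/
structure OmegaSystem {A : Type*} {B : Type*} [Category A] [Category B]
    [Abelian A] [Abelian B] (push : A ⥤ B) (pull : B ⥤ A)
    [push.Additive] [pull.Additive] where
  adj : push ⊣ pull
  isIso_counit : IsIso adj.counit
  pull_epi : ∀ ⦃X Y : B⦄ (f : X ⟶ Y), Epi f → Epi (pull.map f)

/-- `(P_*, ∂_*)` together with the augmentation `ε : P₀ ⟶ θ^*(X)` is an Ω-resolution of
`X` with respect to the Ω-system `(𝒜, ℬ, θ_*, θ^*)`: (Ω-1) each `P_n` is projective;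
(Ω-2) the augmented complex `θ_*(P_*) ⟶ θ_*θ^*(X) ⟶ 0` is exact; (Ω-3) each homology
object `H_n(P_*)`, `n ≥ 1`, lies in the essential image of `θ^*`, and `ε` induces an
isomorphism `H₀(P_*) ≅ θ^*(X)` (i.e. `ε` is an epimorphism and `P₁ → P₀ → θ^*(X)` is
exact). -/
structure IsOmegaResolution {A : Type*} {B : Type*} [Category A] [Category B]
    [Abelian A] [Abelian B] (push : A ⥤ B) (pull : B ⥤ A)
    {X : B} (P : ChainComplex A ℕ) (ε : P.X 0 ⟶ pull.obj X) : Prop where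
  projective : ∀ n, Projective (P.X n)
  comm : P.d 1 0 ≫ ε = 0
  push_comm : push.map (P.d 1 0) ≫ push.map ε = 0
  push_d : ∀ n : ℕ, push.map (P.d (n + 2) (n + 1)) ≫ push.map (P.d (n + 1) n) = 0
  push_epi : Epi (push.map ε)
  push_exact₀ : (ShortComplex.mk (push.map (P.d 1 0)) (push.map ε) push_comm).Exact
  push_exact : ∀ n : ℕ, (ShortComplex.mk (push.map (P.d (n + 2) (n + 1)))
    (push.map (P.d (n + 1) n)) (push_d n)).Exact
  homology_essImage : ∀ n : ℕ, 1 ≤ n → pull.essImage (P.homology n)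
  eps_epi : Epi ε
  exact₀ : (ShortComplex.mk (P.d 1 0) ε comm).Exact

namespace OmegaAux

/-- Preservation of cokernel exactness under a left adjoint. -/
theorem push_exact_epi {A : Type*} {B : Type*} [Category A] [Category B] [Abelian A] [Abelian B]
    {push : A ⥤ B} {pull : B ⥤ A} [push.Additive] [pull.Additive]
    (adj : push ⊣ pull) (E : ShortComplex A) (hE : E.Exact) (he : Epi E.g) :
    (E.map push).Exact ∧ Epi (push.map E.g) := by
  have := adj.leftAdjoint_preservesColimits
  exact ⟨hE.map_of_epi_of_preservesCokernel push he inferInstance, inferInstance⟩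

theorem unit_epi {A : Type*} {B : Type*} [Category A] [Category B] [Abelian A] [Abelian B]
    {push : A ⥤ B} {pull : B ⥤ A} [push.Additive] [pull.Additive]
    (S : OmegaSystem push pull)
    (hsub : ∀ {A₁ A₂ : A} (i : A₁ ⟶ A₂), Mono i → pull.essImage A₂ → pull.essImage A₁)
    (M : A) : Epi (S.adj.unit.app M) := by
  have := S.isIso_counit
  have ff := S.adj.fullyFaithfulROfIsIsoCounit
  obtain ⟨V, ⟨e⟩⟩ := hsub (image.ι (S.adj.unit.app M)) inferInstance (pull.obj_mem_essImage _)
  let g : push.obj M ⟶ V := (S.adj.homEquiv _ _).symm (factorThruImage (S.adj.unit.app M) ≫ e.inv)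
  have hg : S.adj.unit.app M ≫ pull.map g = factorThruImage (S.adj.unit.app M) ≫ e.inv := by
    exact (S.adj.homEquiv_unit (X := M) (Y := V) (f := g)).symm.trans (Equiv.apply_symm_apply _ _)
  let h : V ⟶ push.obj M := ff.preimage (e.hom ≫ image.ι (S.adj.unit.app M))
  have hh : pull.map h = e.hom ≫ image.ι (S.adj.unit.app M) := ff.map_preimage _
  have hgh : g ≫ h = 𝟙 _ := by
    apply (S.adj.homEquiv _ _).injective
    rw [S.adj.homEquiv_unit, S.adj.homEquiv_unit, pull.map_comp, reassoc_of% hg, hh]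
    simp
  have h1 : (pull.map g ≫ e.hom) ≫ image.ι (S.adj.unit.app M) = 𝟙 _ := by
    rw [Category.assoc, ← hh, ← pull.map_comp, hgh, pull.map_id]
  have : Epi (image.ι (S.adj.unit.app M)) := by
    have : IsSplitEpi (image.ι (S.adj.unit.app M)) := ⟨⟨⟨_, h1⟩⟩⟩
    infer_instance
  rw [← image.fac (S.adj.unit.app M)]
  exact epi_comp _ _

theorem push_mono {A : Type*} {B : Type*} [Category A] [Category B] [Abelian A] [Abelian B]
    {push : A ⥤ B} {pull : B ⥤ A} [push.Additive] [pull.Additive]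
    (S : OmegaSystem push pull)
    (hext : ∀ E : ShortComplex A, E.ShortExact →
      pull.essImage E.X₁ → pull.essImage E.X₃ → pull.essImage E.X₂)
    (E : ShortComplex A) (hE : E.ShortExact) (h3 : pull.essImage E.X₃) :
    Mono (push.map E.f) := by
  have := S.isIso_counit
  have ff := S.adj.fullyFaithfulROfIsIsoCounit
  have := ff.faithful
  have := hE.mono_f
  have := hE.epi_g
  let η := S.adj.unit.app E.X₁
  let inl : E.X₂ ⟶ pushout E.f η := pushout.inl _ _
  let inr : pull.obj (push.obj E.X₁) ⟶ pushout E.f η := pushout.inr _ _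
  have cond : E.f ≫ inl = η ≫ inr := pushout.condition
  let c : pushout E.f η ⟶ E.X₃ := pushout.desc E.g 0 (by simp)
  have hc1 : inl ≫ c = E.g := pushout.inl_desc _ _ _
  have hc2 : inr ≫ c = 0 := pushout.inr_desc _ _ _
  have : Mono inr := inferInstanceAs (Mono (pushout.inr E.f η))
  have : Epi c := by
    have : Epi (inl ≫ c) := by rw [hc1]; infer_instance
    exact epi_of_epi inl c
  have hex : (ShortComplex.mk inr c hc2).Exact := by
    apply ShortComplex.exact_of_g_is_cokernel
    refine CokernelCofork.IsColimit.ofπ _ _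
      (fun {Z} k hk => hE.exact.desc (inl ≫ k) (by
        rw [reassoc_of% cond]; dsimp at hk; rw [hk, comp_zero])) ?_ ?_
    · intro Z k hk
      dsimp at hk ⊢
      apply pushout.hom_ext
      · change inl ≫ c ≫ _ = inl ≫ k
        rw [reassoc_of% hc1]; exact hE.exact.g_desc _ _
      · change inr ≫ c ≫ _ = inr ≫ k
        rw [reassoc_of% hc2, zero_comp]; exact hk.symm
    · intro Z k hk m hm
      dsimp at hm
      rw [← cancel_epi E.g, hE.exact.g_desc, ← hm, reassoc_of% hc1]
  obtain ⟨V, ⟨e⟩⟩ := hext (ShortComplex.mk inr c hc2) { exact := hex, mono_f := ‹_›, epi_g := ‹_› }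
    (pull.obj_mem_essImage _) h3
  change pull.obj V ≅ pushout E.f η at e
  let u : push.obj E.X₂ ⟶ V := (S.adj.homEquiv _ _).symm (inl ≫ e.inv)
  have hu : S.adj.unit.app E.X₂ ≫ pull.map u = inl ≫ e.inv := by
    exact (S.adj.homEquiv_unit (X := E.X₂) (Y := V) (f := u)).symm.trans (Equiv.apply_symm_apply _ _)
  let v : push.obj E.X₁ ⟶ V := ff.preimage (inr ≫ e.inv)
  have hv : pull.map v = inr ≫ e.inv := ff.map_preimage _
  have : Mono v := by
    apply pull.mono_of_mono_map
    rw [hv]; infer_instance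
  have huv : push.map E.f ≫ u = v := by
    apply (S.adj.homEquiv _ _).injective
    rw [S.adj.homEquiv_unit, S.adj.homEquiv_unit, pull.map_comp, hv]
    have := S.adj.unit.naturality E.f
    dsimp at this
    rw [← reassoc_of% this, hu, reassoc_of% cond]
  have : Mono (push.map E.f ≫ u) := by rw [huv]; infer_instance
  exact mono_of_mono (push.map E.f) u

/-- One step of the construction. -/
structure Step {A : Type*} {B : Type*} [Category A] [Category B] [Abelian A] [Abelian B]
    (push : A ⥤ B) (pull : B ⥤ A) [push.Additive] [pull.Additive] (M : A) where
  P : A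
  M' : A
  p : P ⟶ M
  j : M' ⟶ P
  w : j ≫ p = 0
  proj : Projective P
  epi_p : Epi p
  mono_j : Mono j
  hom_mem : pull.essImage (ShortComplex.mk j p w).homology
  exact_of_mem : pull.essImage M → (ShortComplex.mk j p w).Exact
  push_mono_j : Mono (push.map j)
  push_epi_p : Epi (push.map p)
  push_exact : ((ShortComplex.mk j p w).map push).Exact
  proj' : Projective (push.obj M')

theorem exists_step {A : Type*} {B : Type*} [Category A] [Category B] [Abelian A] [Abelian B]
    [EnoughProjectives A]
    {push : A ⥤ B} {pull : B ⥤ A} [push.Additive] [pull.Additive]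
    (S : OmegaSystem push pull)
    (hsub : ∀ {A₁ A₂ : A} (i : A₁ ⟶ A₂), Mono i → pull.essImage A₂ → pull.essImage A₁)
    (hext : ∀ E : ShortComplex A, E.ShortExact →
      pull.essImage E.X₁ → pull.essImage E.X₃ → pull.essImage E.X₂)
    (M : A) (hM : Projective (push.obj M)) : Nonempty (Step push pull M) := by
  have := S.isIso_counit
  let P := Projective.over M
  let p : P ⟶ M := Projective.π M
  have : pull.PreservesEpimorphisms := ⟨fun f hf => S.pull_epi f hf⟩
  have hLP : Projective (push.obj P) := S.adj.map_projective P inferInstance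
  let Z := kernel p
  let k : Z ⟶ P := kernel.ι p
  have hkp : k ≫ p = 0 := kernel.condition p
  have hE : (ShortComplex.mk k p hkp).ShortExact :=
    { exact := ShortComplex.exact_of_f_is_kernel _ (kernelIsKernel p)
      mono_f := inferInstanceAs (Mono (kernel.ι p))
      epi_g := inferInstanceAs (Epi (Projective.π M)) }
  obtain ⟨hLE, hLp⟩ := push_exact_epi S.adj _ hE.exact hE.epi_g
  change Epi (push.map p) at hLp
  let N := kernel (push.map p)
  have hLkp : push.map k ≫ push.map p = 0 := by rw [← push.map_comp, hkp, push.map_zero]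
  let l : push.obj Z ⟶ N := kernel.lift (push.map p) (push.map k) hLkp
  have hl : l ≫ kernel.ι (push.map p) = push.map k := kernel.lift_ι _ _ _
  have : Epi l := hLE.epi_kernelLift
  -- `N` is projective
  let σ : push.obj M ⟶ push.obj P := Projective.factorThru (𝟙 _) (push.map p)
  have hσ : σ ≫ push.map p = 𝟙 _ := Projective.factorThru_comp _ _
  have hN : Projective N := by
    let ρ : push.obj P ⟶ N := kernel.lift (push.map p) (𝟙 _ - push.map p ≫ σ) (by
      simp [hσ])
    have hρ : kernel.ι (push.map p) ≫ ρ = 𝟙 _ := by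
      rw [← cancel_mono (kernel.ι (push.map p))]
      simp [ρ]
    exact Retract.projective (Y := push.obj P) ⟨kernel.ι (push.map p), ρ, hρ⟩
  let s : N ⟶ push.obj Z := Projective.factorThru (𝟙 _) l
  have hs : s ≫ l = 𝟙 _ := Projective.factorThru_comp _ _
  let J := kernel l
  let r : push.obj Z ⟶ J := kernel.lift l (𝟙 _ - l ≫ s) (by simp [hs])
  have hr : r ≫ kernel.ι l = 𝟙 _ - l ≫ s := kernel.lift_ι _ _ _
  have hir : kernel.ι l ≫ r = 𝟙 _ := by
    rw [← cancel_mono (kernel.ι l), Category.assoc, hr]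
    simp
  have : Epi r := by
    have : IsSplitEpi r := ⟨⟨⟨_, hir⟩⟩⟩
    infer_instance
  have := unit_epi S hsub Z
  have := S.pull_epi r inferInstance
  let t : Z ⟶ pull.obj J := S.adj.unit.app Z ≫ pull.map r
  have ht : Epi t := epi_comp _ _
  have htr : push.map t ≫ S.adj.counit.app J = r := by
    have := S.adj.homEquiv_counit (X := Z) (Y := J) (g := t)
    rw [← this]
    apply (S.adj.homEquiv _ _).injective
    rw [Equiv.apply_symm_apply, S.adj.homEquiv_unit]
  let m : kernel t ⟶ Z := kernel.ι t
  have hmt : m ≫ t = 0 := kernel.condition t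
  have hF : (ShortComplex.mk m t hmt).ShortExact :=
    { exact := ShortComplex.exact_of_f_is_kernel _ (kernelIsKernel t)
      mono_f := inferInstanceAs (Mono (kernel.ι t))
      epi_g := ht }
  have hLm : Mono (push.map m) := push_mono S hext _ hF (pull.obj_mem_essImage _)
  obtain ⟨hLF, hLt⟩ := push_exact_epi S.adj _ hF.exact hF.epi_g
  change Epi (push.map t) at hLt
  have hmr : push.map m ≫ r = 0 := by
    rw [← htr, ← Category.assoc, ← push.map_comp, hmt, push.map_zero, zero_comp]
  have hw : (m ≫ k) ≫ p = 0 := by rw [Category.assoc, hkp, comp_zero]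
  -- `L M' ⟶ N` is an isomorphism
  have hmono : Mono (push.map m ≫ l) := by
    apply Preadditive.mono_of_cancel_zero
    intro T x hx
    have h1 : x ≫ push.map m = 0 := by
      have : (x ≫ push.map m) ≫ (r ≫ kernel.ι l) = 0 := by
        rw [Category.assoc, reassoc_of% hmr, zero_comp, comp_zero]
      rw [hr, Preadditive.comp_sub, Category.comp_id, sub_eq_zero] at this
      rw [this, Category.assoc, reassoc_of% hx, zero_comp]
    rw [← cancel_mono (push.map m), h1, zero_comp]
  have hepi : Epi (push.map m ≫ l) := by
    apply Preadditive.epi_of_cancel_zero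
    intro T z hz
    have : Epi ((ShortComplex.mk m t hmt).map push).g := hLt
    let y : push.obj (pull.obj J) ⟶ T := hLF.desc (l ≫ z) ((Category.assoc _ _ _).symm.trans hz)
    have hy : push.map t ≫ y = l ≫ z := hLF.g_desc _ _
    have hy' : r ≫ inv (S.adj.counit.app J) ≫ y = l ≫ z := by
      rw [← htr, Category.assoc, IsIso.hom_inv_id_assoc, hy]
    have h0 : inv (S.adj.counit.app J) ≫ y = 0 := by
      have := kernel.ι l ≫= hy'
      rw [reassoc_of% hir, kernel.condition_assoc, zero_comp] at this
      exact this
    rw [← cancel_epi l, ← hy', h0]; simp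
  have : IsIso (push.map m ≫ l) := isIso_of_mono_of_epi _
  have hLmk : push.map (m ≫ k) = (push.map m ≫ l) ≫ kernel.ι (push.map p) := by
    rw [push.map_comp, Category.assoc, hl]
  let hd : (ShortComplex.mk (m ≫ k) p hw).LeftHomologyData :=
    { K := Z
      H := pull.obj J
      i := k
      π := t
      wi := hkp
      hi := kernelIsKernel p
      wπ := by
        have : (kernelIsKernel p).lift (KernelFork.ofι (m ≫ k) hw) = m := by
          rw [← cancel_mono (kernel.ι p)]
          exact (kernelIsKernel p).fac _ WalkingParallelPair.zero
        exact (congrArg (· ≫ t) this).trans hmt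
      hπ := by
        have : (kernelIsKernel p).lift (KernelFork.ofι (m ≫ k) hw) = m := by
          rw [← cancel_mono (kernel.ι p)]
          exact (kernelIsKernel p).fac _ WalkingParallelPair.zero
        have hEt : Epi (ShortComplex.mk m t hmt).g := ht
        refine CokernelCofork.IsColimit.ofπ _ _ (fun {T} g hg => hF.exact.desc g ?_) ?_ ?_
        · exact (congrArg (· ≫ g) this).symm.trans hg
        · intro T g hg
          exact hF.exact.g_desc _ _
        · intro T g hg x hx
          rw [← cancel_epi t]
          exact hx.trans (hF.exact.g_desc _ _).symm }
  refine ⟨{ P := P, M' := kernel t, p := p, j := m ≫ k, w := hw, proj := inferInstance, epi_p := hE.epi_g, mono_j := ?_, hom_mem := ?_, exact_of_mem := ?_, push_mono_j := ?_, push_epi_p := hLp, push_exact := ?_, proj' := ?_ }⟩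
  · have := hE.mono_f
    have := hF.mono_f
    exact mono_comp m k
  · exact ⟨J, ⟨hd.homologyIso.symm⟩⟩
  · intro hMem
    have hLk : Mono (push.map k) := push_mono S hext _ hE hMem
    have : Mono l := by
      rw [← hl] at hLk
      exact mono_of_mono l (kernel.ι (push.map p))
    have hJ : IsZero J := isZero_kernel_of_mono l
    rw [ShortComplex.exact_iff_isZero_homology]
    exact (pull.map_isZero hJ).of_iso hd.homologyIso
  · rw [hLmk]; infer_instance
  · rw [ShortComplex.exact_iff_epi_kernel_lift]
    have h0 : push.map (m ≫ k) ≫ push.map p = 0 := by rw [← push.map_comp, hw, push.map_zero]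
    have h1 : kernel.lift (push.map p) (push.map (m ≫ k)) h0 = push.map m ≫ l := by
      rw [← cancel_mono (kernel.ι (push.map p)), kernel.lift_ι]
      exact hLmk
    change Epi (kernel.lift (push.map p) (push.map (m ≫ k)) h0)
    rw [h1]; exact hepi
  · exact Projective.of_iso (asIso (push.map m ≫ l)).symm hN

end OmegaAux

/-- If `(𝒜, ℬ, θ_*, θ^*)` is an Ω-system such that `𝒜` has enough projectives and the
essential image of `θ^*` is closed under subobjects and under extensions in `𝒜`, then
every projective object `X` of `ℬ` admits an Ω-resolution. -/
theorem omegaSystem_exists_omegaResolution_of_closed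
    {A : Type*} {B : Type*} [Category A] [Category B] [Abelian A] [Abelian B]
    [EnoughProjectives A]
    (push : A ⥤ B) (pull : B ⥤ A) [push.Additive] [pull.Additive]
    (S : OmegaSystem push pull)
    (hsub : ∀ {A₁ A₂ : A} (i : A₁ ⟶ A₂), Mono i → pull.essImage A₂ → pull.essImage A₁)
    (hext : ∀ E : ShortComplex A, E.ShortExact →
      pull.essImage E.X₁ → pull.essImage E.X₃ → pull.essImage E.X₂)
    (X : B) (hX : Projective X) :
    ∃ (P : ChainComplex A ℕ) (ε : P.X 0 ⟶ pull.obj X),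
      IsOmegaResolution push pull P ε := by
  classical
  have := S.isIso_counit
  let next : ∀ M : {M : A // Projective (push.obj M)}, OmegaAux.Step push pull M.1 := fun M =>
    (OmegaAux.exists_step S hsub hext M.1 M.2).some
  let Ms : ℕ → {M : A // Projective (push.obj M)} := fun n =>
    Nat.rec ⟨pull.obj X, Projective.of_iso (asIso (S.adj.counit.app X)).symm hX⟩
      (fun _ M => ⟨(next M).M', (next M).proj'⟩) n
  let st : ∀ n, OmegaAux.Step push pull (Ms n).1 := fun n => next (Ms n)
  let j : ∀ n, (Ms (n + 1)).1 ⟶ (st n).P := fun n => (st n).j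
  have hj : ∀ n, Mono (j n) := fun n => (st n).mono_j
  have hLj : ∀ n, Mono (push.map (j n)) := fun n => (st n).push_mono_j
  have hp : ∀ n, Epi (st n).p := fun n => (st n).epi_p
  have hLp : ∀ n, Epi (push.map (st n).p) := fun n => (st n).push_epi_p
  have w : ∀ n, j n ≫ (st n).p = 0 := fun n => (st n).w
  let d : ∀ n, (st (n + 1)).P ⟶ (st n).P := fun n => (st (n + 1)).p ≫ j n
  have sq : ∀ n, d (n + 1) ≫ d n = 0 := fun n => by
    dsimp only [d]
    rw [Category.assoc, reassoc_of% (w (n + 1)), zero_comp, comp_zero]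
  let P : ChainComplex A ℕ := ChainComplex.of (fun n => (st n).P) d sq
  have hd : ∀ n, P.d (n + 1) n = d n := fun n => ChainComplex.of_d (fun n => (st n).P) d n
  have comm : P.d 1 0 ≫ (st 0).p = 0 := by
    have h : d 0 ≫ (st 0).p = 0 := by
      dsimp only [d]
      rw [Category.assoc, w 0, comp_zero]
    exact (congrArg (· ≫ (st 0).p) (hd 0)).trans h
  have hdL : ∀ n, push.map (P.d (n + 2) (n + 1)) ≫ push.map (P.d (n + 1) n) = 0 := fun n => by
    rw [← push.map_comp, P.d_comp_d, push.map_zero]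
  have commL : push.map (P.d 1 0) ≫ push.map (st 0).p = 0 := by
    rw [← push.map_comp, comm, push.map_zero]
  -- comparison morphisms
  let φ₀ : ShortComplex.mk (P.d 1 0) (st 0).p comm ⟶ ShortComplex.mk (j 0) (st 0).p (w 0) :=
    { τ₁ := (st 1).p
      τ₂ := 𝟙 _
      τ₃ := 𝟙 _
      comm₁₂ := by
        change (st 1).p ≫ j 0 = P.d 1 0 ≫ 𝟙 _
        rw [Category.comp_id, hd 0]
      comm₂₃ := by
        change 𝟙 _ ≫ (st 0).p = (st 0).p ≫ 𝟙 _
        rw [Category.comp_id, Category.id_comp] }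
  let φL₀ : ShortComplex.mk (push.map (P.d 1 0)) (push.map (st 0).p) commL ⟶
      (ShortComplex.mk (j 0) (st 0).p (w 0)).map push := push.mapShortComplex.map φ₀
  have : Epi φ₀.τ₁ := hp 1
  have : IsIso φ₀.τ₂ := inferInstanceAs (IsIso (𝟙 _))
  have : Mono φ₀.τ₃ := inferInstanceAs (Mono (𝟙 _))
  have : Epi φL₀.τ₁ := hLp 1
  have : IsIso φL₀.τ₂ := inferInstanceAs (IsIso (push.map (𝟙 _)))
  have : Mono φL₀.τ₃ := inferInstanceAs (Mono (push.map (𝟙 _)))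
  have hsw : ∀ n, (st (n + 1)).p ≫ j n = P.d (n + 1) n := fun n => (hd n).symm
  let ψ : ∀ n, P.sc' (n + 2) (n + 1) n ⟶
      ShortComplex.mk (j (n + 1)) (P.d (n + 1) n) (by rw [hd n]; dsimp only [d]; rw [reassoc_of% (w (n+1)), zero_comp]) := fun n =>
    { τ₁ := (st (n + 2)).p
      τ₂ := 𝟙 _
      τ₃ := 𝟙 _
      comm₁₂ := by
        change (st (n + 2)).p ≫ j (n + 1) = P.d (n + 2) (n + 1) ≫ 𝟙 _
        rw [Category.comp_id, hd (n + 1)]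
      comm₂₃ := by
        change 𝟙 _ ≫ P.d (n + 1) n = P.d (n + 1) n ≫ 𝟙 _
        rw [Category.comp_id, Category.id_comp] }
  let χ : ∀ n, ShortComplex.mk (j (n + 1)) (st (n + 1)).p (w (n + 1)) ⟶
      ShortComplex.mk (j (n + 1)) (P.d (n + 1) n) (by rw [hd n]; dsimp only [d]; rw [reassoc_of% (w (n+1)), zero_comp]) := fun n =>
    { τ₁ := 𝟙 _
      τ₂ := 𝟙 _
      τ₃ := j n
      comm₁₂ := by
        change 𝟙 _ ≫ j (n + 1) = j (n + 1) ≫ 𝟙 _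
        rw [Category.comp_id, Category.id_comp]
      comm₂₃ := by
        change 𝟙 _ ≫ P.d (n + 1) n = (st (n + 1)).p ≫ j n
        rw [Category.id_comp, hd n] }
  refine ⟨P, (st 0).p, ?_⟩
  refine
    { projective := fun n => (st n).proj
      comm := comm
      push_comm := commL
      push_d := hdL
      push_epi := hLp 0
      push_exact₀ := ?_
      push_exact := ?_
      homology_essImage := ?_
      eps_epi := hp 0
      exact₀ := ?_ }
  · rw [ShortComplex.exact_iff_of_epi_of_isIso_of_mono φL₀]
    exact (st 0).push_exact
  · intro n
    let ψL := push.mapShortComplex.map (ψ n)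
    let χL := push.mapShortComplex.map (χ n)
    have : Epi ψL.τ₁ := hLp (n + 2)
    have : IsIso ψL.τ₂ := inferInstanceAs (IsIso (push.map (𝟙 _)))
    have : Mono ψL.τ₃ := inferInstanceAs (Mono (push.map (𝟙 _)))
    have : Epi χL.τ₁ := inferInstanceAs (Epi (push.map (𝟙 _)))
    have : IsIso χL.τ₂ := inferInstanceAs (IsIso (push.map (𝟙 _)))
    have : Mono χL.τ₃ := hLj n
    exact (ShortComplex.exact_iff_of_epi_of_isIso_of_mono ψL).2
      ((ShortComplex.exact_iff_of_epi_of_isIso_of_mono χL).1 (st (n + 1)).push_exact)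
  · intro n hn
    obtain ⟨n, rfl⟩ : ∃ m, n = m + 1 := ⟨n - 1, by omega⟩
    have : Epi (ψ n).τ₁ := hp (n + 2)
    have : IsIso (ψ n).τ₂ := inferInstanceAs (IsIso (𝟙 _))
    have : Mono (ψ n).τ₃ := inferInstanceAs (Mono (𝟙 _))
    have : Epi (χ n).τ₁ := inferInstanceAs (Epi (𝟙 _))
    have : IsIso (χ n).τ₂ := inferInstanceAs (IsIso (𝟙 _))
    have : Mono (χ n).τ₃ := hj n
    have := ShortComplex.quasiIso_of_epi_of_isIso_of_mono (ψ n)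
    have := ShortComplex.quasiIso_of_epi_of_isIso_of_mono (χ n)
    have e1 : P.homology (n + 1) ≅ (P.sc' (n + 2) (n + 1) n).homology :=
      ShortComplex.homologyMapIso (P.isoSc' (n + 2) (n + 1) n (by simp) (by simp))
    have e2 := asIso (ShortComplex.homologyMap (ψ n))
    have e3 := asIso (ShortComplex.homologyMap (χ n))
    exact pull.essImage.prop_of_iso (e1 ≪≫ e2 ≪≫ e3.symm).symm (st (n + 1)).hom_mem
  · rw [ShortComplex.exact_iff_of_epi_of_isIso_of_mono φ₀]
    exact (st 0).exact_of_mem (pull.obj_mem_essImage X)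
end

section
/- Let R be a commutative ring and θ : G → π a surjective group homomorphism with kernel K, and assume K is not R-perfect. Consider the Ω-system given by θ_* = R[π] ⊗_{R[G]} — : R[G]-Mod ⥤ R[π]-Mod and restriction of scalars θ^* : R[π]-Mod ⥤ R[G]-Mod. Then for every nonzero R[π]-module X whose underlying R-module is free, (L₁θ_*)(θ^*(X)) ≠ 0; in particular, no nonzero projective R[π]-module that is free as an R-module admits an Ω-resolution with respect to this Ω-system, and the essential image of θ^* is not closed under extensions in R[G]-Mod. -/
open CategoryTheory CategoryTheory.Limits

universe u

/-- A group `K` is `R`-perfect if `K^{ab} ⊗_ℤ R = 0`. -/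
def IsRPerfect (R : Type*) [CommRing R] (K : Type*) [Group K] : Prop :=
  Subsingleton (TensorProduct ℤ (Additive (Abelianization K)) R)

/-- Functions `H → A`, on which `H` acts by right translation. -/
def CoFun (_R H A : Type u) : Type u := H → A

instance (R H A : Type u) [AddCommGroup A] : AddCommGroup (CoFun R H A) :=
  inferInstanceAs (AddCommGroup (H → A))

/-- The right translation representation. -/
def coFunRep (R H A : Type u) [CommRing R] [Group H] [AddCommGroup A] [Module R A] :
    Representation R H (H → A) where
  toFun h :=
    { toFun := fun f g => f (g * h)
      map_add' := fun _ _ => rfl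
      map_smul' := fun _ _ => rfl }
  map_one' := by
    ext f g
    simp
  map_mul' h h' := by
    refine LinearMap.ext fun f => funext fun g => ?_
    simp [mul_assoc]

noncomputable instance (R H A : Type u) [CommRing R] [Group H] [AddCommGroup A] [Module R A] :
    Module (MonoidAlgebra R H) (CoFun R H A) :=
  Module.compHom (H → A) (coFunRep R H A).asAlgebraHom.toRingHom

theorem coFun_single_smul (R H A : Type u) [CommRing R] [Group H] [AddCommGroup A] [Module R A]
    (h : H) (r : R) (f : CoFun R H A) (g : H) :
    (MonoidAlgebra.single h r • f : CoFun R H A) g = r • f (g * h) := by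
  change ((coFunRep R H A).asAlgebraHom (MonoidAlgebra.single h r)) f g = _
  rw [Representation.asAlgebraHom_single]
  rfl

theorem coFun_add_apply (R H A : Type u) [AddCommGroup A] (f f' : CoFun R H A) (g : H) :
    (f + f') g = f g + f' g := rfl

theorem coFun_zero_apply (R H A : Type u) [AddCommGroup A] (g : H) :
    (0 : CoFun R H A) g = 0 := rfl

section ext
variable {R : Type u} [CommRing R] {G π : Type u} [Group G] [Group π] (θ : G →* π)

theorem mapDomain_single' (g : G) (r : R) :
    MonoidAlgebra.mapDomainRingHom R θ (MonoidAlgebra.single g r) =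
      MonoidAlgebra.single (θ g) r := by
  simp

theorem res_single_smul (X : ModuleCat.{u} (MonoidAlgebra R π)) (g : G) (r : R)
    (x : (ModuleCat.restrictScalars (MonoidAlgebra.mapDomainRingHom R θ)).obj X) :
    (MonoidAlgebra.single g r : MonoidAlgebra R G) • x =
      (show (ModuleCat.restrictScalars (MonoidAlgebra.mapDomainRingHom R θ)).obj X from
      ((MonoidAlgebra.single (θ g) r : MonoidAlgebra R π) • (show X from x))) := by
  rw [← mapDomain_single']
  rfl

theorem res_ker_smul (X : ModuleCat.{u} (MonoidAlgebra R π)) (g : G) (hg : g ∈ θ.ker)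
    (x : (ModuleCat.restrictScalars (MonoidAlgebra.mapDomainRingHom R θ)).obj X) :
    (MonoidAlgebra.single g 1 : MonoidAlgebra R G) • x = x := by
  rw [res_single_smul, MonoidHom.mem_ker.1 hg, ← MonoidAlgebra.one_def]
  exact one_smul (MonoidAlgebra R π) (show X from x)

variable {A : Type u} [AddCommGroup A] [Module R A] (X : ModuleCat.{u} (MonoidAlgebra R π))
  (l : X →+ R) (φ : θ.ker → A)

/-- The condition defining the extension. -/
def extCond (x : X) (f : G → A) : Prop :=
  ∀ (k : θ.ker) (g : G), f (k * g) =
    f g + l ((MonoidAlgebra.single (θ g) (1 : R) : MonoidAlgebra R π) • x) • φ k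

/-- The extension module. -/
def extMod (hl : ∀ (r : R) (x : X),
      l ((MonoidAlgebra.single 1 r : MonoidAlgebra R π) • x) = r * l x) :
    Submodule (MonoidAlgebra R G)
      ((ModuleCat.restrictScalars (MonoidAlgebra.mapDomainRingHom R θ)).obj X × CoFun R G A) where
  carrier := {e | extCond θ X l φ e.1 e.2}
  zero_mem' := by
    intro k g
    change (0 : A) = 0 + l (_ • (0 : X)) • φ k
    simp
  add_mem' := by
    intro a b ha hb k g
    have h1 := ha k g
    have h2 := hb k g
    change a.2 (k * g) + b.2 (k * g) = (a.2 g + b.2 g) + l (_ • ((show X from a.1) + (show X from b.1))) • φ k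
    rw [h1, h2, smul_add, map_add, add_smul]
    abel
  smul_mem' := by
    intro c a ha
    induction c using MonoidAlgebra.induction_linear with
    | zero =>
      intro k g
      rw [zero_smul]
      change (0 : A) = 0 + l (_ • (0 : X)) • φ k
      simp
    | add c d hc hd =>
      intro k g
      have h1 := hc k g
      have h2 := hd k g
      rw [add_smul]
      change (c • a).2 (k * g) + (d • a).2 (k * g) = ((c • a).2 g + (d • a).2 g) +
        l (_ • ((show X from (c • a).1) + (show X from (d • a).1))) • φ k
      rw [h1, h2, smul_add, map_add, add_smul]
      abel
    | single h r =>
      intro k g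
      rw [Prod.smul_fst, Prod.smul_snd, coFun_single_smul, coFun_single_smul, mul_assoc,
        ha k (g * h), res_single_smul]
      change _ = _ + l ((MonoidAlgebra.single (θ g) (1 : R) : MonoidAlgebra R π) •
        ((MonoidAlgebra.single (θ h) r : MonoidAlgebra R π) • (show X from a.1))) • φ k
      have key : ∀ x : X, l ((MonoidAlgebra.single (θ g) (1 : R) : MonoidAlgebra R π) •
          ((MonoidAlgebra.single (θ h) r : MonoidAlgebra R π) • x)) =
          r * l ((MonoidAlgebra.single (θ (g * h)) (1 : R) : MonoidAlgebra R π) • x) := by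
        intro x
        rw [← hl, smul_smul, smul_smul, MonoidAlgebra.single_mul_single,
          MonoidAlgebra.single_mul_single, one_mul, one_mul, mul_one, map_mul]
      rw [key, mul_smul, ← smul_add]

theorem ext_exists (hθ : Function.Surjective θ) (hl : ∀ (r : R) (x : X),
      l ((MonoidAlgebra.single 1 r : MonoidAlgebra R π) • x) = r * l x)
    (x₀ : X) (hx₀ : l x₀ = 1) (hφ : ∀ k k', φ (k * k') = φ k + φ k')
    (k₀ : θ.ker) (hk₀ : φ k₀ ≠ 0) :
    ∃ (Y : ModuleCat.{u} (MonoidAlgebra R π)) (E : ModuleCat.{u} (MonoidAlgebra R G))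
      (i : (ModuleCat.restrictScalars (MonoidAlgebra.mapDomainRingHom R θ)).obj Y ⟶ E)
      (p : E ⟶ (ModuleCat.restrictScalars (MonoidAlgebra.mapDomainRingHom R θ)).obj X)
      (w : i ≫ p = 0), (ShortComplex.mk i p w).ShortExact ∧
      ∀ e : E, p.hom e = x₀ → (MonoidAlgebra.single (k₀ : G) (1 : R)) • e ≠ e := by
  let Y := ModuleCat.of (MonoidAlgebra R π) (CoFun R π A)
  let E := ModuleCat.of (MonoidAlgebra R G) (extMod θ X l φ hl)
  let i₀ : CoFun R π A → CoFun R G A := fun f g => f (θ g)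
  have hi₀ : ∀ f, ((0, i₀ f) : (ModuleCat.restrictScalars
      (MonoidAlgebra.mapDomainRingHom R θ)).obj X × CoFun R G A) ∈ extMod θ X l φ hl := by
    intro f k g
    change f (θ (k * g)) = f (θ g) + l (_ • (0 : X)) • φ k
    rw [map_mul, MonoidHom.mem_ker.1 k.2]
    simp
  have hsm : ∀ (c : MonoidAlgebra R G) (f : CoFun R π A),
      i₀ (MonoidAlgebra.mapDomainRingHom R θ c • f) = c • i₀ f := by
    intro c f
    induction c using MonoidAlgebra.induction_linear with
    | zero => rw [map_zero, zero_smul, zero_smul]; rfl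
    | add c d hc hd => rw [map_add, add_smul, add_smul, ← hc, ← hd]; rfl
    | single h r =>
      funext g
      rw [mapDomain_single', coFun_single_smul]
      change (MonoidAlgebra.single (θ h) r • f : CoFun R π A) (θ g) = _
      rw [coFun_single_smul, ← map_mul]
  let i : (ModuleCat.restrictScalars (MonoidAlgebra.mapDomainRingHom R θ)).obj Y ⟶ E :=
    ModuleCat.ofHom (X := (ModuleCat.restrictScalars (MonoidAlgebra.mapDomainRingHom R θ)).obj Y)
      { toFun := fun f => ⟨(0, i₀ f), hi₀ f⟩
        map_add' := fun a b => Subtype.ext (Prod.ext (add_zero _).symm rfl)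
        map_smul' := fun c a => Subtype.ext (Prod.ext (smul_zero _).symm (hsm c a)) }
  let p : E ⟶ (ModuleCat.restrictScalars (MonoidAlgebra.mapDomainRingHom R θ)).obj X :=
    ModuleCat.ofHom (Y := (ModuleCat.restrictScalars (MonoidAlgebra.mapDomainRingHom R θ)).obj X)
      ((LinearMap.fst _ _ _).comp (extMod θ X l φ hl).subtype)
  have w : i ≫ p = 0 := by
    ext f
    rfl
  refine ⟨Y, E, i, p, w, ?_, ?_⟩
  · apply ModuleCat.shortComplex_shortExact
    · rw [LinearMap.exact_iff]
      apply le_antisymm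
      · rintro ⟨⟨x, f⟩, hf⟩ hx
        have hx' : x = 0 := hx
        subst hx'
        refine ⟨fun q => f (hθ q).choose, ?_⟩
        refine Subtype.ext (Prod.ext rfl (funext fun g => ?_))
        change f (hθ (θ g)).choose = f g
        have h := (hθ (θ g)).choose_spec
        set g' := (hθ (θ g)).choose
        have hk : g' * g⁻¹ ∈ θ.ker := by simp [MonoidHom.mem_ker, h]
        have := hf ⟨_, hk⟩ g
        change f (g' * g⁻¹ * g) = f g + l (_ • (0 : X)) • _ at this
        simpa using this
      · rintro _ ⟨f, rfl⟩
        rfl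
    · intro f f' h
      have h' : i₀ f = i₀ f' := congrArg (fun e : extMod θ X l φ hl => e.1.2) h
      funext q
      obtain ⟨g, rfl⟩ := hθ q
      exact congrFun h' g
    · intro x
      let s : G → G := fun g => (hθ (θ g)).choose
      have hs : ∀ g, θ (s g) = θ g := fun g => (hθ (θ g)).choose_spec
      have hs' : ∀ (k : θ.ker) g, s (k * g) = s g := by
        intro k g
        have : θ (k * g) = θ g := by rw [map_mul, MonoidHom.mem_ker.1 k.2, one_mul]
        simp only [s, this]
      have hκ : ∀ g, g * (s g)⁻¹ ∈ θ.ker := by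
        intro g; simp [MonoidHom.mem_ker, hs]
      refine ⟨⟨(x, fun g => l ((MonoidAlgebra.single (θ g) (1 : R) : MonoidAlgebra R π) •
        (show X from x)) • φ ⟨_, hκ g⟩), ?_⟩, rfl⟩
      intro k g
      have h1 : (⟨_, hκ (k * g)⟩ : θ.ker) = k * ⟨_, hκ g⟩ := by
        apply Subtype.ext
        simp [hs', mul_assoc]
      have h2 : θ (k * g) = θ g := by rw [map_mul, MonoidHom.mem_ker.1 k.2, one_mul]
      change l ((MonoidAlgebra.single (θ (k * g)) (1 : R) : MonoidAlgebra R π) •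
        (show X from x)) • φ ⟨_, hκ (k * g)⟩ = l ((MonoidAlgebra.single (θ g) (1 : R) :
          MonoidAlgebra R π) • (show X from x)) • φ ⟨_, hκ g⟩ +
          l ((MonoidAlgebra.single (θ g) (1 : R) :
          MonoidAlgebra R π) • (show X from x)) • φ k
      rw [h1, h2, hφ, smul_add, add_comm]
  · rintro ⟨⟨x, f⟩, hf⟩ hx he
    have hx' : x = x₀ := hx
    subst hx'
    have h := congrArg (fun e : extMod θ X l φ hl => e.1.2 1) he
    change (MonoidAlgebra.single (k₀ : G) (1 : R) • f : CoFun R G A) 1 = f 1 at h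
    rw [coFun_single_smul, one_smul, one_mul] at h
    have h2 := hf k₀ 1
    change f (k₀ * 1) = f 1 + l (_ • (show X from x)) • φ k₀ at h2
    rw [mul_one, h, map_one, hl, one_mul, hx₀, one_smul] at h2
    exact hk₀ (by simpa using h2)

end ext

theorem exists_hom {R : Type u} [CommRing R] {K : Type u} [Group K] (hK : ¬ IsRPerfect R K) :
    ∃ (φ : K → TensorProduct ℤ R (Additive (Abelianization K))),
      (∀ k k', φ (k * k') = φ k + φ k') ∧ ∃ k, φ k ≠ 0 := by
  refine ⟨fun k => TensorProduct.tmul ℤ (1 : R) (Additive.ofMul (Abelianization.of k)), ?_, ?_⟩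
  · intro k k'
    dsimp only
    rw [map_mul, ofMul_mul, TensorProduct.tmul_add]
  · by_contra! h
    apply hK
    have : ∀ t : TensorProduct ℤ R (Additive (Abelianization K)), t = 0 := by
      intro t
      induction t using TensorProduct.induction_on with
      | zero => rfl
      | add a b ha hb => rw [ha, hb, add_zero]
      | tmul r a =>
        obtain ⟨k, hk⟩ := QuotientGroup.mk_surjective (s := commutator K) a.toMul
        have h1 := congrArg (fun t => r • t) (h k)
        simp only [TensorProduct.smul_tmul', smul_zero, smul_eq_mul, mul_one] at h1
        rw [← h1]
        congr 1
        exact hk.symm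
    have : Subsingleton (TensorProduct ℤ R (Additive (Abelianization K))) :=
      ⟨fun a b => by rw [this a, this b]⟩
    exact (TensorProduct.comm ℤ (Additive (Abelianization K)) R).toEquiv.subsingleton

theorem exists_functional {R : Type u} [CommRing R] {π : Type u} [Group π]
    (X : ModuleCat.{u} (MonoidAlgebra R π)) (hX : ¬ IsZero X)
    (hF : Module.Free R ((ModuleCat.restrictScalars (algebraMap R (MonoidAlgebra R π))).obj X)) :
    ∃ (l : X →+ R) (x₀ : X), (∀ (r : R) (x : X),
      l ((MonoidAlgebra.single 1 r : MonoidAlgebra R π) • x) = r * l x) ∧ l x₀ = 1 := by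
  obtain ⟨⟨ι, b⟩⟩ := hF.exists_basis
  have hne : Nonempty ι := by
    by_contra h
    rw [not_nonempty_iff] at h
    apply hX
    have := b.repr.toEquiv.subsingleton
    have : Subsingleton X := this
    exact ModuleCat.isZero_of_subsingleton X
  obtain ⟨j⟩ := hne
  refine ⟨(b.coord j).toAddMonoidHom, b j, ?_, ?_⟩
  · intro r x
    exact (b.coord j).map_smul r x
  · change b.coord j (b j) = 1
    simp

theorem key {R : Type u} [CommRing R] {G π : Type u} [Group G] [Group π]
    (θ : G →* π) (hθ : Function.Surjective θ) (hK : ¬ IsRPerfect R θ.ker)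
    (push : ModuleCat.{u} (MonoidAlgebra R G) ⥤ ModuleCat.{u} (MonoidAlgebra R π))
    [push.Additive]
    (adj : push ⊣ ModuleCat.restrictScalars (MonoidAlgebra.mapDomainRingHom R θ))
    (X : ModuleCat.{u} (MonoidAlgebra R π)) (hX : ¬ IsZero X)
    (hF : Module.Free R ((ModuleCat.restrictScalars (algebraMap R (MonoidAlgebra R π))).obj X))
    {P₂ P₁ P₀ : ModuleCat.{u} (MonoidAlgebra R G)} (d₂ : P₂ ⟶ P₁) (d₁ : P₁ ⟶ P₀)
    (ε : P₀ ⟶ (ModuleCat.restrictScalars (MonoidAlgebra.mapDomainRingHom R θ)).obj X)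
    [Projective P₀] [Epi ε] (hd : d₂ ≫ d₁ = 0) (hε : d₁ ≫ ε = 0)
    (hex : (ShortComplex.mk d₁ ε hε).Exact)
    (hd' : push.map d₂ ≫ push.map d₁ = 0)
    (hex' : (ShortComplex.mk (push.map d₂) (push.map d₁) hd').Exact) : False := by
  obtain ⟨φ, hφ, k₀, hk₀⟩ := exists_hom hK
  obtain ⟨l, x₀, hl, hx₀⟩ := exists_functional X hX hF
  obtain ⟨Y, E, i, p, w, hS, hE⟩ := ext_exists θ X l φ hθ hl x₀ hx₀ hφ k₀ hk₀
  have := hS.epi_g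
  have := hS.mono_f
  dsimp at *
  let ι := Injective.ι Y
  let r : P₀ ⟶ E := Projective.factorThru ε p
  have hr : r ≫ p = ε := Projective.factorThru_comp _ _
  let a : P₁ ⟶ _ := hS.exact.lift (d₁ ≫ r) (by simp [hr, hε])
  have ha : a ≫ i = d₁ ≫ r := hS.exact.lift_f _ _
  let c : push.obj P₁ ⟶ Injective.under Y := (adj.homEquiv _ _).symm
    (a ≫ (ModuleCat.restrictScalars (MonoidAlgebra.mapDomainRingHom R θ)).map ι)
  have hda : d₂ ≫ a = 0 := by
    rw [← cancel_mono i, Category.assoc, ha, ← Category.assoc, hd]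
    simp
  have hc : push.map d₂ ≫ c = 0 := by
    rw [← Adjunction.homEquiv_naturality_left_symm, ← Category.assoc, hda, zero_comp]
    simp [Adjunction.homEquiv_counit]
  let q₀ := hex'.descToInjective c hc
  have hq₀ : push.map d₁ ≫ q₀ = c := hex'.comp_descToInjective _ _
  let q := adj.homEquiv _ _ q₀
  have hq : d₁ ≫ q = a ≫
      (ModuleCat.restrictScalars (MonoidAlgebra.mapDomainRingHom R θ)).map ι := by
    rw [← Adjunction.homEquiv_naturality_left, hq₀, Equiv.apply_symm_apply]
  obtain ⟨z, hz⟩ := (ModuleCat.epi_iff_surjective ε).1 inferInstance x₀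
  apply hE (r.hom z)
  · rw [← hz, ← hr]; rfl
  · have h1 : ε.hom ((MonoidAlgebra.single (k₀ : G) (1 : R)) • z - z) = 0 := by
      rw [map_sub, map_smul, res_ker_smul _ _ _ k₀.2, sub_self]
    obtain ⟨v, hv⟩ := (ShortComplex.moduleCat_exact_iff _).1 hex _ h1
    have hv' : d₁.hom v = (MonoidAlgebra.single (k₀ : G) (1 : R)) • z - z := hv
    have h2 : q.hom (d₁.hom v) = 0 := by
      rw [hv', map_sub, map_smul, res_ker_smul _ _ _ k₀.2, sub_self]
    have h3 : ι.hom (show Y from a.hom v) = 0 := by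
      have := congrArg (fun t => t.hom v) hq
      exact this.symm.trans h2
    have h4 : a.hom v = 0 :=
      (ModuleCat.mono_iff_injective ι).1 inferInstance (h3.trans (map_zero ι.hom).symm)
    have h5 : r.hom (d₁.hom v) = 0 := by
      have := congrArg (fun t => t.hom v) ha
      refine this.symm.trans ?_
      change i.hom (a.hom v) = 0
      rw [h4, map_zero]
    rw [hv', map_sub, map_smul] at h5
    exact sub_eq_zero.1 h5

/-- Let `R` be a commutative ring and `θ : G → π` a surjective group homomorphism whose
kernel is *not* `R`-perfect.  For the Ω-system given by extension of scalars
`θ_* = R[π] ⊗_{R[G]} —` (i.e. any additive left adjoint of restriction of scalars with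
invertible counit) and restriction of scalars `θ^*`: the essential image of `θ^*` is not
closed under extensions in `R[G]`-Mod, and for every nonzero `R[π]`-module `X` that is
free as an `R`-module one has `(L₁θ_*)(θ^*(X)) ≠ 0`; in particular no such `X` that is
projective admits an Ω-resolution. -/
theorem monoidAlgebra_no_omegaResolution_of_ker_not_perfect
    (R : Type u) [CommRing R] {G π : Type u} [Group G] [Group π]
    (θ : G →* π) (hθ : Function.Surjective θ)
    (hK : ¬ IsRPerfect R θ.ker) :
    (¬ ∀ E : ShortComplex (ModuleCat.{u} (MonoidAlgebra R G)), E.ShortExact →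
      (ModuleCat.restrictScalars (MonoidAlgebra.mapDomainRingHom R θ)).essImage E.X₁ →
      (ModuleCat.restrictScalars (MonoidAlgebra.mapDomainRingHom R θ)).essImage E.X₃ →
      (ModuleCat.restrictScalars (MonoidAlgebra.mapDomainRingHom R θ)).essImage E.X₂) ∧
    (∀ (push : ModuleCat.{u} (MonoidAlgebra R G) ⥤ ModuleCat.{u} (MonoidAlgebra R π))
      [push.Additive]
      (adj : push ⊣ ModuleCat.restrictScalars (MonoidAlgebra.mapDomainRingHom R θ)),
      IsIso adj.counit →
      ∀ X : ModuleCat.{u} (MonoidAlgebra R π), ¬ IsZero X →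
        Module.Free R
          ((ModuleCat.restrictScalars (algebraMap R (MonoidAlgebra R π))).obj X) →
        ¬ IsZero ((push.leftDerived 1).obj
            ((ModuleCat.restrictScalars (MonoidAlgebra.mapDomainRingHom R θ)).obj X)) ∧
        (Projective X →
          ¬ ∃ (P : ChainComplex (ModuleCat.{u} (MonoidAlgebra R G)) ℕ)
            (ε : P.X 0 ⟶
              (ModuleCat.restrictScalars (MonoidAlgebra.mapDomainRingHom R θ)).obj X),
            IsOmegaResolution push
              (ModuleCat.restrictScalars (MonoidAlgebra.mapDomainRingHom R θ)) P ε)) := by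
  refine ⟨?_, ?_⟩
  · intro H
    let X := ModuleCat.of (MonoidAlgebra R π) (MonoidAlgebra R π)
    obtain ⟨φ, hφ, k₀, hk₀⟩ := exists_hom hK
    have hl : ∃ (l : X →+ R) (x₀ : X), (∀ (r : R) (x : X),
        l ((MonoidAlgebra.single 1 r : MonoidAlgebra R π) • x) = r * l x) ∧ l x₀ = 1 := by
      refine ⟨{ toFun := fun x => MonoidAlgebra.coeff (show MonoidAlgebra R π from x) 1
                map_zero' := rfl, map_add' := fun _ _ => rfl },
        (1 : MonoidAlgebra R π), ?_, ?_⟩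
      · intro r x
        change MonoidAlgebra.coeff
          (MonoidAlgebra.single 1 r * (show MonoidAlgebra R π from x)) 1 = _
        simp
        rfl
      · change MonoidAlgebra.coeff (1 : MonoidAlgebra R π) 1 = 1
        simp
    obtain ⟨l, x₀, hl, hx₀⟩ := hl
    obtain ⟨Y, E, i, p, w, hS, hE⟩ := ext_exists θ X l φ hθ hl x₀ hx₀ hφ k₀ hk₀
    obtain ⟨Z, ⟨e⟩⟩ := H _ hS (Functor.obj_mem_essImage _ _) (Functor.obj_mem_essImage _ _)
    have := hS.epi_g
    obtain ⟨z, hz⟩ := (ModuleCat.epi_iff_surjective p).1 this x₀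
    apply hE z hz
    have h1 := res_ker_smul θ Z k₀ k₀.2 (e.inv.hom z)
    rw [← map_smul] at h1
    exact (ModuleCat.mono_iff_injective e.inv).1 inferInstance h1
  · intro push _ adj _ X hX hF
    refine ⟨?_, ?_⟩
    · intro hz
      let Q := projectiveResolution
        ((ModuleCat.restrictScalars (MonoidAlgebra.mapDomainRingHom R θ)).obj X)
      have h1 := hz.of_iso (Q.isoLeftDerivedObj push 1).symm
      have h2 : (((push.mapHomologicalComplex _).obj Q.complex).ExactAt 1) := by
        rw [HomologicalComplex.exactAt_iff_isZero_homology]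
        exact h1
      rw [HomologicalComplex.exactAt_iff' _ 2 1 0 (by simp) (by simp)] at h2
      have : Epi (Q.π.f 0) := inferInstance
      have : @Epi _ _ (Q.complex.X 0)
        ((ModuleCat.restrictScalars (MonoidAlgebra.mapDomainRingHom R θ)).obj X) (Q.π.f 0) := this
      exact key θ hθ hK push adj X hX hF (Q.complex.d 2 1) (Q.complex.d 1 0) (Q.π.f 0)
        (by simp) Q.complex_d_comp_π_f_zero Q.exact₀ _ h2
    · rintro - ⟨P, ε, h⟩
      have := h.projective 0
      have := h.eps_epi
      exact key θ hθ hK push adj X hX hF (P.d 2 1) (P.d 1 0) ε (by simp) h.comm h.exact₀ _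
        (h.push_exact 0)
end
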